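/- arXiv:1609.01335 — 5 statements merged into one kernel-verified Lean document; each statement's English description precedes it below -/
import Mathlib

section
/- Up to equivalence (orientation-preserving isomorphism) there is exactly one Newton graph of order 2, and it is self-dual. -/
/-- The setoid on darts given by the same-cycle relation of a permutation. -/
def cycleSetoid {D : Type} (p : Equiv.Perm D) : Setoid D :=
  ⟨p.SameCycle, ⟨fun x => Equiv.Perm.SameCycle.refl p x,
    fun h => h.symm, fun h₁ h₂ => h₁.trans h₂⟩⟩

/-- The number of orbits (cycles, including fixed points) of a permutation. -/
noncomputable def orbitCount {D : Type} (p : Equiv.Perm D) : ℕ :=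
  Nat.card (Quotient (cycleSetoid p))

/-- The size of the `p`-orbit of the dart `d` (the degree of the vertex,
resp. face, containing `d`, when `p` is `σ`, resp. `φ = σ ∘ α`). -/
noncomputable def orbSize {D : Type} (p : Equiv.Perm D) (d : D) : ℕ :=
  Nat.card {x : D // p.SameCycle d x}

/-- `(D, σ, α)` is a combinatorial map of order `r`: `D` has `4r` darts, `α` is a
fixed-point-free involution (its orbits are the `2r` edges), the orbits of `σ` are the
`r` vertices, the orbits of `φ = σ ∘ α` are the `r` faces, the group generated by `σ`
and `α` acts transitively on `D` (connectedness), and no edge has both of its darts in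
the same vertex orbit (no loops). -/
def IsCMap (r : ℕ) {D : Type} (σ α : Equiv.Perm D) : Prop :=
  2 ≤ r ∧ Nat.card D = 4 * r ∧
  (∀ d, α d ≠ d) ∧ (∀ d, α (α d) = d) ∧
  (∀ d d' : D, ∃ g ∈ Subgroup.closure ({σ, α} : Set (Equiv.Perm D)), g d = d') ∧
  orbitCount σ = r ∧ orbitCount (σ * α) = r ∧
  (∀ d, ¬ σ.SameCycle d (α d))

/-- The E(uler)-property: every face orbit contains at most one dart of each edge,
and contains at least one dart of each vertex orbit. -/
def EulerProp {D : Type} (σ α : Equiv.Perm D) : Prop :=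
  (∀ d, ¬ (σ * α).SameCycle d (α d)) ∧
  (∀ d d' : D, ∃ x, (σ * α).SameCycle d x ∧ σ.SameCycle d' x)

/-- A Newton graph of order `r`: a combinatorial map of order `r` with the E-property. -/
def IsNewtonGraph (r : ℕ) {D : Type} (σ α : Equiv.Perm D) : Prop :=
  IsCMap r σ α ∧ EulerProp σ α

/-- Orientation-preserving isomorphism (equivalence) of combinatorial maps. -/
def MapEquiv {D D' : Type} (σ α : Equiv.Perm D) (σ' α' : Equiv.Perm D') : Prop :=
  ∃ e : D ≃ D', (∀ d, e (σ d) = σ' (e d)) ∧ (∀ d, e (α d) = α' (e d))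

/-- Orientation-preserving or orientation-reversing isomorphism of combinatorial maps. -/
def MapIso {D D' : Type} (σ α : Equiv.Perm D) (σ' α' : Equiv.Perm D') : Prop :=
  ∃ e : D ≃ D', (∀ d, e (α d) = α' (e d)) ∧
    ((∀ d, e (σ d) = σ' (e d)) ∨ (∀ d, e (σ d) = σ'⁻¹ (e d)))

/-- A combinatorial map is self-dual if it is equivalent (orientation-preservingly)
to its reversed dual `(D, (σ ∘ α)⁻¹, α)`. -/
def MapSelfDual {D : Type} (σ α : Equiv.Perm D) : Prop :=
  MapEquiv σ α (σ * α)⁻¹ α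

open Function

section OrbitTools

variable {D : Type}

/-- A permutation whose cycles are the fibres of a surjection onto `Bool` has two orbits. -/
theorem orbitCount_eq_two_of_sameCycle_iff {p : Equiv.Perm D} {f : D → Bool}
    (hf : Surjective f) (h : ∀ x y, p.SameCycle x y ↔ f x = f y) : orbitCount p = 2 := by
  have hs : cycleSetoid p = Setoid.ker f := Setoid.ext fun x y => h x y
  rw [orbitCount, hs, Nat.card_congr (Setoid.quotientKerEquivOfSurjective f hf),
    Nat.card_eq_fintype_card, Fintype.card_bool]

theorem sameCycle_iff_of_invariant {β : Type*} {p : Equiv.Perm D} {f : D → β}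
    (hinv : ∀ x, f (p x) = f x) (htrans : ∀ x y, f x = f y → ∃ k : Fin 4, p^[k] x = y)
    (x y : D) : p.SameCycle x y ↔ f x = f y := by
  refine ⟨?_, fun h => ?_⟩
  · rintro ⟨i, rfl⟩
    induction i with
    | zero => rfl
    | succ n ih => rw [add_comm, zpow_add, zpow_one, Equiv.Perm.mul_apply, hinv, ih]
    | pred n ih =>
      rw [sub_eq_neg_add, zpow_add, zpow_neg_one, Equiv.Perm.mul_apply, ih]
      exact (congrArg f (p.apply_symm_apply _)).symm.trans (hinv _)
  · obtain ⟨k, rfl⟩ := htrans x y h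
    exact ⟨(k : ℕ), by rw [zpow_natCast, Equiv.Perm.iterate_eq_pow]⟩

variable {p α : Equiv.Perm D}

/-- If a permutation has two orbits and `x`, `y` lie in different ones,
every point lies in the orbit of `x` or in that of `y`. -/
theorem sameCycle_or_of_orbitCount_eq_two (hp : orbitCount p = 2) {x y : D}
    (hxy : ¬ p.SameCycle x y) (z : D) : p.SameCycle x z ∨ p.SameCycle y z := by
  have hne : (Quotient.mk (cycleSetoid p) x) ≠ Quotient.mk (cycleSetoid p) y :=
    fun h => hxy (Quotient.exact h)
  obtain ⟨a, b, -, hab⟩ := Nat.card_eq_two_iff.1 hp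
  have key : ∀ q : Quotient (cycleSetoid p), q = a ∨ q = b := fun q => by
    simpa using hab.ge (Set.mem_univ q)
  have : Quotient.mk (cycleSetoid p) x = Quotient.mk _ z ∨
      Quotient.mk (cycleSetoid p) y = Quotient.mk _ z := by
    have := key (Quotient.mk _ x)
    have := key (Quotient.mk _ y)
    have := key (Quotient.mk _ z)
    grind
  exact this.imp Quotient.exact Quotient.exact

/-- If an involution on eight points exchanges the two orbits of `p`,
every point has period four under `p`. -/
theorem minimalPeriod_eq_four (hD : Nat.card D = 8) (hα : ∀ d, α (α d) = d)
    (hp : orbitCount p = 2) (hpα : ∀ d, ¬ p.SameCycle d (α d)) (d : D) :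
    minimalPeriod p d = 4 := by
  have : Finite D := Nat.finite_of_card_ne_zero (by omega)
  have hflip : ∀ x, p.SameCycle d (α x) ↔ ¬ p.SameCycle d x := by
    refine fun x => ⟨fun h h' => hpα x (h'.symm.trans h), fun h => ?_⟩
    exact ((sameCycle_or_of_orbitCount_eq_two hp (hpα x) d).resolve_left
      fun h' => h h'.symm).symm
  have himage : α '' {x | p.SameCycle d x} = {x | p.SameCycle d x}ᶜ := by
    ext x
    refine ⟨?_, fun hx => ⟨α x, (hflip x).2 hx, hα x⟩⟩
    rintro ⟨y, hy, rfl⟩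
    exact fun h => (hflip y).1 h hy
  have hcard := Set.ncard_add_ncard_compl {x | p.SameCycle d x}
  rw [← himage, Set.ncard_image_of_injective _ α.injective, hD] at hcard
  have horbit : MulAction.orbit (Subgroup.zpowers p) d = {x | p.SameCycle d x} := by
    ext x
    simp [MulAction.mem_orbit_iff, Equiv.Perm.SameCycle, Subgroup.smul_def]
  have := Fintype.ofFinite D
  have := Fintype.ofFinite (MulAction.orbit (Subgroup.zpowers p) d)
  have hmin : minimalPeriod (p • ·) d = minimalPeriod p d := rfl
  rw [← hmin, MulAction.minimalPeriod_eq_card, ← Nat.card_eq_fintype_card,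
    Nat.card_coe_set_eq, horbit]
  omega

end OrbitTools

section NewtonGraph

variable {D : Type} {σ α : Equiv.Perm D}

theorem IsNewtonGraph.sigma_iterate_four (h : IsNewtonGraph 2 σ α) (d : D) :
    σ (σ (σ (σ d))) = d := by
  obtain ⟨⟨-, hD, -, hα, -, hσ, -, hσα⟩, -⟩ := h
  have := isPeriodicPt_minimalPeriod σ d
  rwa [minimalPeriod_eq_four hD hα hσ hσα] at this

theorem IsNewtonGraph.exists_iterate (h : IsNewtonGraph 2 σ α) {d x : D}
    (hx : σ.SameCycle d x) : x = d ∨ x = σ d ∨ x = σ (σ d) ∨ x = σ (σ (σ d)) := by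
  have hσ4 : σ ^ (4 : ℤ) = 1 := Equiv.ext h.sigma_iterate_four
  obtain ⟨i, rfl⟩ := hx
  have hi : σ ^ i = σ ^ (i % 4) := by
    conv_lhs => rw [← Int.emod_add_mul_ediv i 4, zpow_add, zpow_mul, hσ4, one_zpow, mul_one]
  have hmod : i % 4 = 0 ∨ i % 4 = 1 ∨ i % 4 = 2 ∨ i % 4 = 3 := by omega
  rw [hi]
  rcases hmod with h0 | h1 | h2 | h3
  · exact .inl (by rw [h0]; rfl)
  · exact .inr (.inl (by rw [h1]; rfl))
  · exact .inr (.inr (.inl (by rw [h2]; rfl)))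
  · exact .inr (.inr (.inr (by rw [h3]; rfl)))

/-- In a Newton graph of order two, the vertex rotation commutes with the edge involution. -/
theorem IsNewtonGraph.sigma_alpha_comm (h : IsNewtonGraph 2 σ α) (d : D) :
    σ (α d) = α (σ d) := by
  have h' := h
  obtain ⟨⟨-, hD, -, hα, -, hσ, hφ, hσα⟩, hφα, -⟩ := h'
  have hface : ∀ x, (σ * α).SameCycle x (σ (α x)) := fun x => ⟨1, rfl⟩
  have hvertex : σ.SameCycle d (σ (α (σ (α d)))) := by
    have hstep : ∀ x, σ.SameCycle x (σ x) := fun x => ⟨1, rfl⟩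
    have hcross := sameCycle_or_of_orbitCount_eq_two hσ (hσα (α d)) (α (σ (α d)))
    rw [hα] at hcross
    exact (hcross.resolve_left fun hc =>
      hσα _ ((hstep (α d)).symm.trans hc)).trans (hstep _)
  have hφφ : (σ * α).SameCycle d (σ (α (σ (α d)))) := (hface d).trans (hface _)
  rcases h.exists_iterate hvertex with hk | hk | hk | hk
  · have hper : IsPeriodicPt (σ * α) 2 d := hk
    have := hper.minimalPeriod_le two_pos
    rw [minimalPeriod_eq_four hD hα hφ hφα] at this
    omega
  · have hopp := hface (α d)
    rw [hα, ← hk] at hopp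
    exact absurd (hφφ.trans hopp.symm) (hφα d)
  · rw [← hα (σ (α d)), σ.injective hk]
  · have hopp := hface (α (σ (σ (σ d))))
    rw [hα, h.sigma_iterate_four, ← hk] at hopp
    exact absurd (hφφ.symm.trans hopp.symm) (hφα _)

end NewtonGraph

/-- The vertex rotation of the Newton graph of order two on the darts `Fin 8`. -/
def newtonSigma : Equiv.Perm (Fin 8) where
  toFun := ![1, 2, 3, 0, 5, 6, 7, 4]
  invFun := ![3, 0, 1, 2, 7, 4, 5, 6]
  left_inv := by decide
  right_inv := by decide

/-- The edge involution of the Newton graph of order two on the darts `Fin 8`. -/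
def newtonAlpha : Equiv.Perm (Fin 8) where
  toFun := ![4, 5, 6, 7, 0, 1, 2, 3]
  invFun := ![4, 5, 6, 7, 0, 1, 2, 3]
  left_inv := by decide
  right_inv := by decide

theorem newtonSigma_sameCycle_iff (x y : Fin 8) :
    newtonSigma.SameCycle x y ↔ decide (x < 4) = decide (y < 4) :=
  sameCycle_iff_of_invariant (f := fun x : Fin 8 => decide (x < 4)) (by decide) (by decide) x y

theorem newtonFace_sameCycle_iff (x y : Fin 8) :
    (newtonSigma * newtonAlpha).SameCycle x y ↔
      decide (x ∈ ({0, 2, 5, 7} : Finset (Fin 8))) = decide (y ∈ ({0, 2, 5, 7} : Finset (Fin 8))) :=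
  sameCycle_iff_of_invariant (f := fun x : Fin 8 => decide (x ∈ ({0, 2, 5, 7} : Finset (Fin 8))))
    (by decide) (by decide) x y

theorem isNewtonGraph_newton : IsNewtonGraph 2 newtonSigma newtonAlpha := by
  refine ⟨⟨le_rfl, by simp, by decide, by decide, fun d d' => ?_, ?_, ?_, ?_⟩, ?_, ?_⟩
  · have hreach : ∀ d d' : Fin 8, ∃ i : Fin 4, ∃ j : Fin 2,
        (newtonSigma ^ (i : ℕ) * newtonAlpha ^ (j : ℕ)) d = d' := by decide
    obtain ⟨i, j, hij⟩ := hreach d d'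
    exact ⟨_, mul_mem (pow_mem (Subgroup.subset_closure (by simp)) _)
      (pow_mem (Subgroup.subset_closure (by simp)) _), hij⟩
  · exact orbitCount_eq_two_of_sameCycle_iff (by decide) newtonSigma_sameCycle_iff
  · exact orbitCount_eq_two_of_sameCycle_iff (by decide) newtonFace_sameCycle_iff
  · simp only [newtonSigma_sameCycle_iff]
    decide
  · simp only [newtonFace_sameCycle_iff]
    decide
  · simp only [newtonFace_sameCycle_iff, newtonSigma_sameCycle_iff]
    decide

theorem mapSelfDual_newton : MapSelfDual newtonSigma newtonAlpha :=
  ⟨⟨![0, 7, 2, 5, 4, 3, 6, 1], ![0, 7, 2, 5, 4, 3, 6, 1], by decide, by decide⟩,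
    by decide, by decide⟩

theorem IsNewtonGraph.mapEquiv_newton {D : Type} {σ α : Equiv.Perm D}
    (h : IsNewtonGraph 2 σ α) : MapEquiv σ α newtonSigma newtonAlpha := by
  have h' := h
  obtain ⟨⟨-, hD, -, hα, -, hσ, -, hσα⟩, -⟩ := h'
  have hcomm := h.sigma_alpha_comm
  have h4 := h.sigma_iterate_four
  have : Finite D := Nat.finite_of_card_ne_zero (by omega)
  obtain ⟨d⟩ : Nonempty D := (Nat.card_pos_iff.1 (by omega)).1
  let f : Fin 8 → D := ![d, σ d, σ (σ d), σ (σ (σ d)),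
    α d, σ (α d), σ (σ (α d)), σ (σ (σ (α d)))]
  have hsurj : Surjective f := fun x => by
    rcases sameCycle_or_of_orbitCount_eq_two hσ (hσα d) x with hx | hx <;>
      rcases h.exists_iterate hx with rfl | rfl | rfl | rfl
    exacts [⟨0, rfl⟩, ⟨1, rfl⟩, ⟨2, rfl⟩, ⟨3, rfl⟩, ⟨4, rfl⟩, ⟨5, rfl⟩, ⟨6, rfl⟩, ⟨7, rfl⟩]
  have hbij : Bijective f := hsurj.bijective_of_nat_card_le (by simp [hD])
  have hfσ : ∀ n, f (newtonSigma n) = σ (f n) := by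
    intro n
    fin_cases n <;> simp [f, newtonSigma, h4]
  have hfα : ∀ n, f (newtonAlpha n) = α (f n) := by
    intro n
    fin_cases n <;> simp [f, newtonAlpha, hcomm, hα]
  let e := Equiv.ofBijective f hbij
  have he : ∀ n, e n = f n := fun _ => rfl
  refine ⟨e.symm, fun x => ?_, fun x => ?_⟩ <;> rw [Equiv.symm_apply_eq, he]
  · rw [hfσ, ← he, e.apply_symm_apply]
  · rw [hfα, ← he, e.apply_symm_apply]

/-- Up to equivalence (orientation-preserving isomorphism) there is exactly one
Newton graph of order 2, and it is self-dual. -/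
theorem newton_graphs_order2_unique_and_self_dual :
    ∃ σ₀ α₀ : Equiv.Perm (Fin 8),
      IsNewtonGraph 2 σ₀ α₀ ∧ MapSelfDual σ₀ α₀ ∧
      (∀ (D : Type) (σ α : Equiv.Perm D), IsNewtonGraph 2 σ α →
        MapEquiv σ α σ₀ α₀) :=
  ⟨newtonSigma, newtonAlpha, isNewtonGraph_newton, mapSelfDual_newton,
    fun _ _ _ h => h.mapEquiv_newton⟩
end

section
/- For every Newton graph of order 3: each vertex degree δ satisfies 1 < δ ≤ 6, each face degree δ* satisfies 1 < δ* ≤ 6, the sum of the three vertex degrees equals 12, and the sum of the three face degrees equals 12. -/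
/-- If every orbit of `q` meets the `p`-orbit of `d`, then that orbit has at least as many
elements as `q` has orbits. -/
theorem orbitCount_le_orbSize {D : Type} [Finite D] (p q : Equiv.Perm D) (d : D)
    (h : ∀ d' : D, ∃ x, p.SameCycle d x ∧ q.SameCycle d' x) :
    orbitCount q ≤ orbSize p d := by
  refine Nat.card_le_card_of_surjective
    (fun x : {x : D // p.SameCycle d x} => Quotient.mk (cycleSetoid q) x.1) fun y => ?_
  induction y using Quotient.inductionOn with
  | h d' =>
    obtain ⟨x, hpx, hqx⟩ := h d'
    exact ⟨⟨x, hpx⟩, Quotient.sound hqx.symm⟩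

/-- If no `p`-orbit contains both `x` and `α x` for any `x`, then every `p`-orbit fills at most
half of the set. -/
theorem two_mul_orbSize_le_card {D : Type} [Finite D] (p α : Equiv.Perm D) (d : D)
    (h : ∀ x, ¬ p.SameCycle x (α x)) :
    2 * orbSize p d ≤ Nat.card D := by
  have hinj : Function.Injective (Sum.elim (fun x : {x : D // p.SameCycle d x} => x.1)
      (fun x : {x : D // p.SameCycle d x} => α x.1)) := by
    refine Function.Injective.sumElim Subtype.val_injective
      (α.injective.comp Subtype.val_injective) fun a b hab => ?_
    exact h b.1 (hab ▸ b.2.symm.trans a.2)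
  have hcard := Nat.card_le_card_of_injective _ hinj
  rwa [Nat.card_sum, ← two_mul] at hcard

/-- The orbit sizes of a complete system of orbit representatives sum to the cardinality. -/
theorem sum_orbSize_eq_card {D : Type} [Finite D] (p : Equiv.Perm D) {r : ℕ}
    (hr : orbitCount p = r) (f : Fin r → D)
    (hf : ∀ i j, p.SameCycle (f i) (f j) → i = j) :
    ∑ i, orbSize p (f i) = Nat.card D := by
  have hinj : Function.Injective fun i => Quotient.mk (cycleSetoid p) (f i) :=
    fun i j hij => hf i j (Quotient.exact hij)
  have hsurj := (hinj.bijective_of_nat_card_le (by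
    rw [Nat.card_fin]; exact hr.le)).surjective
  have hbij : Function.Bijective
      fun x : Σ i, {x : D // p.SameCycle (f i) x} => x.2.1 := by
    constructor
    · rintro ⟨i, x, hx⟩ ⟨j, y, hy⟩ hxy
      obtain rfl : x = y := hxy
      obtain rfl := hf i j (hx.trans hy.symm)
      rfl
    · intro x
      obtain ⟨i, hi⟩ := hsurj (Quotient.mk (cycleSetoid p) x)
      exact ⟨⟨i, x, Quotient.exact hi⟩, rfl⟩
  rw [← Nat.card_eq_of_bijective _ hbij, Nat.card_sigma]
  rfl

/-- Three pairwise distinct orbits of a permutation with exactly three orbits exhaust the set. -/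
theorem orbSize_add_add_eq_card {D : Type} [Finite D] (p : Equiv.Perm D)
    (hp : orbitCount p = 3) (d₁ d₂ d₃ : D) (h₁₂ : ¬ p.SameCycle d₁ d₂)
    (h₁₃ : ¬ p.SameCycle d₁ d₃) (h₂₃ : ¬ p.SameCycle d₂ d₃) :
    orbSize p d₁ + orbSize p d₂ + orbSize p d₃ = Nat.card D := by
  have hsum := sum_orbSize_eq_card p hp ![d₁, d₂, d₃] (by
    intro i j hij
    have hji := hij.symm
    fin_cases i <;> fin_cases j <;> first | rfl | exact absurd hij ‹_› | exact absurd hji ‹_›)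
  simpa [Fin.sum_univ_three] using hsum

/-- For every Newton graph of order 3: each vertex degree δ satisfies 1 < δ ≤ 6,
each face degree δ* satisfies 1 < δ* ≤ 6, the three vertex degrees sum to 12, and
the three face degrees sum to 12. -/
theorem newton_graph_order3_degree_bounds
    {D : Type} (σ α : Equiv.Perm D) (h : IsNewtonGraph 3 σ α) :
    (∀ d : D, 1 < orbSize σ d ∧ orbSize σ d ≤ 6) ∧
    (∀ d : D, 1 < orbSize (σ * α) d ∧ orbSize (σ * α) d ≤ 6) ∧
    (∀ d₁ d₂ d₃ : D, ¬ σ.SameCycle d₁ d₂ → ¬ σ.SameCycle d₁ d₃ →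
      ¬ σ.SameCycle d₂ d₃ →
      orbSize σ d₁ + orbSize σ d₂ + orbSize σ d₃ = 12) ∧
    (∀ d₁ d₂ d₃ : D, ¬ (σ * α).SameCycle d₁ d₂ → ¬ (σ * α).SameCycle d₁ d₃ →
      ¬ (σ * α).SameCycle d₂ d₃ →
      orbSize (σ * α) d₁ + orbSize (σ * α) d₂ + orbSize (σ * α) d₃ = 12) := by
  obtain ⟨⟨-, hcard, -, -, -, hσ, hφ, hloop⟩, hedge, hmeet⟩ := h
  have hfin : Finite D := Nat.finite_of_card_ne_zero (by omega)
  refine ⟨fun d => ?_, fun d => ?_, fun d₁ d₂ d₃ h₁₂ h₁₃ h₂₃ => ?_,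
    fun d₁ d₂ d₃ h₁₂ h₁₃ h₂₃ => ?_⟩
  · have hlow := orbitCount_le_orbSize σ (σ * α) d fun d' =>
      (hmeet d' d).imp fun _ hx => hx.symm
    have hupp := two_mul_orbSize_le_card σ α d hloop
    omega
  · have hlow := orbitCount_le_orbSize (σ * α) σ d (hmeet d)
    have hupp := two_mul_orbSize_le_card (σ * α) α d hedge
    omega
  · exact (orbSize_add_add_eq_card σ hσ d₁ d₂ d₃ h₁₂ h₁₃ h₂₃).trans hcard
  · exact (orbSize_add_add_eq_card (σ * α) hφ d₁ d₂ d₃ h₁₂ h₁₃ h₂₃).trans hcard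
end

section
/- The dual of a Newton graph of order 3 is again a Newton graph of order 3; that is, if the combinatorial map (D, σ, α) of order 3 has the E-property, then (D, σ ∘ α, α) is a combinatorial map of order 3 (in particular it is loopless) and has the E-property. -/
/-- Right multiplication of one generator by the other does not change the generated subgroup. -/
theorem closure_mul_pair_eq {G : Type*} [Group G] (a b : G) :
    Subgroup.closure ({a * b, b} : Set G) = Subgroup.closure {a, b} := by
  have ha : a ∈ Subgroup.closure ({a, b} : Set G) := Subgroup.subset_closure (by simp)
  have hb : b ∈ Subgroup.closure ({a, b} : Set G) := Subgroup.subset_closure (by simp)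
  have hab : a * b ∈ Subgroup.closure ({a * b, b} : Set G) := Subgroup.subset_closure (by simp)
  have hb' : b ∈ Subgroup.closure ({a * b, b} : Set G) := Subgroup.subset_closure (by simp)
  apply le_antisymm <;> rw [Subgroup.closure_le]
  · rintro z (rfl | rfl)
    · exact mul_mem ha hb
    · exact hb
  · rintro z (rfl | rfl)
    · simpa using mul_mem hab (inv_mem hb')
    · exact hb'

/-- The dual of a Newton graph of any order is a Newton graph of the same order. -/
theorem IsNewtonGraph.dual {r : ℕ} {D : Type} {σ α : Equiv.Perm D} (h : IsNewtonGraph r σ α) :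
    IsNewtonGraph r (σ * α) α := by
  obtain ⟨⟨hr, hcard, hfix, hinv, htrans, hσ, hφ, hloop⟩, hedge, hmeet⟩ := h
  have hφα : σ * α * α = σ := by
    ext d
    simp [hinv]
  refine ⟨⟨hr, hcard, hfix, hinv, ?_, hφ, ?_, hedge⟩, ?_, ?_⟩
  · rwa [closure_mul_pair_eq]
  · rwa [hφα]
  · rwa [hφα]
  · intro d d'
    obtain ⟨x, hx, hx'⟩ := hmeet d' d
    exact ⟨x, by rwa [hφα], hx⟩

/-- The dual `(D, σ ∘ α, α)` of a Newton graph `(D, σ, α)` of order 3 is again a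
Newton graph of order 3. -/
theorem newton_graph_order3_dual
    {D : Type} (σ α : Equiv.Perm D) (h : IsNewtonGraph 3 σ α) :
    IsNewtonGraph 3 (σ * α) α :=
  h.dual
end

section
/- Among the loop-free cyclic words of length 6 over {1,2,3} in which one letter occurs three times, one letter occurs twice and one letter occurs once, there is exactly one class up to rotation and relabeling, represented by (1,2,1,2,1,3). (This is the unique vertex-sequence scheme of a facial walk of length 6 of a third-order Newton graph in which one vertex appears three times, one twice and one once.) -/
/-- A cyclic word `w : ZMod n → Fin 3` is loop-free if consecutive letters differ. -/
def LoopFree {n : ℕ} (w : ZMod n → Fin 3) : Prop :=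
  ∀ i, w i ≠ w (i + 1)

/-- Two cyclic words are the same up to rotation and relabeling of the alphabet. -/
def SameWord {n : ℕ} (w w' : ZMod n → Fin 3) : Prop :=
  ∃ (t : ZMod n) (π : Equiv.Perm (Fin 3)), ∀ i, w' i = π (w (i + t))

/-- The representative cyclic word `(1,2,3,1,2,3)` (letters coded as `0,1,2`). -/
def word123123 : ZMod 6 → Fin 3 :=
  fun i => ![0, 1, 2, 0, 1, 2] ⟨i.val, i.val_lt⟩

/-- The representative cyclic word `(1,2,3,2,1,3)` (letters coded as `0,1,2`). -/
def word123213 : ZMod 6 → Fin 3 :=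
  fun i => ![0, 1, 2, 1, 0, 2] ⟨i.val, i.val_lt⟩

/-- The representative cyclic word `(1,2,1,2,1,3)` (letters coded as `0,1,2`). -/
def word121213 : ZMod 6 → Fin 3 :=
  fun i => ![0, 1, 0, 1, 0, 2] ⟨i.val, i.val_lt⟩

/-- The representative cyclic word `(1,3,2,1,2)` (letters coded as `0,1,2`). -/
def word13212 : ZMod 5 → Fin 3 :=
  fun i => ![0, 2, 1, 0, 1] ⟨i.val, i.val_lt⟩

/-- A loop-free cyclic word of length 6 whose letter `c` occurs only at `k`, whose other letters
are `a` and `b`, and in which `b` occurs twice, reads `a, b, a, b, a, c` from `k + 1` on. -/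
lemma LoopFree.eq_alternating {w : ZMod 6 → Fin 3} (hw : LoopFree w) {a b c : Fin 3}
    (habc : ∀ d, d = a ∨ d = b ∨ d = c) (hb : Nat.card {i : ZMod 6 // w i = b} = 2)
    {k : ZMod 6} (hk : ∀ i, w i = c → i = k) :
    w (k + 1) = a ∧ w (k + 2) = b ∧ w (k + 3) = a ∧ w (k + 4) = b ∧ w (k + 5) = a := by
  have hab : ∀ m : ZMod 6, m ≠ 0 → w (k + m) = a ∨ w (k + m) = b := by
    intro m hm
    rcases habc (w (k + m)) with h | h | h
    · exact .inl h
    · exact .inr h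
    · exact absurd (by simpa using hk _ h) hm
  have hstep : ∀ m n : ZMod 6, m + 1 = n → w (k + m) ≠ w (k + n) := by
    rintro m _ rfl
    simpa [add_assoc] using hw (k + m)
  have h12 := hstep 1 2 (by decide)
  have h23 := hstep 2 3 (by decide)
  have h34 := hstep 3 4 (by decide)
  have h45 := hstep 4 5 (by decide)
  have hnot : ¬ (w (k + 1) = b ∧ w (k + 3) = b ∧ w (k + 5) = b) := by
    rintro ⟨h1, h3, h5⟩
    rw [Nat.card_eq_fintype_card, Fintype.card_subtype] at hb
    have hsub : ({k + 1, k + 3, k + 5} : Finset (ZMod 6)) ⊆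
        Finset.univ.filter (w · = b) := by
      simp [Finset.insert_subset_iff, h1, h3, h5]
    have hcard : ∀ k : ZMod 6, ({k + 1, k + 3, k + 5} : Finset (ZMod 6)).card = 3 := by decide
    have := Finset.card_le_card hsub
    rw [hcard, hb] at this
    omega
  have h1 := hab 1 (by decide)
  have h2 := hab 2 (by decide)
  have h3 := hab 3 (by decide)
  have h4 := hab 4 (by decide)
  have h5 := hab 5 (by decide)
  grind

/-- Three distinct letters can be relabeled to `0, 1, 2`. -/
lemma exists_perm_eq_zero_one_two :
    ∀ a b c : Fin 3, a ≠ b → a ≠ c → b ≠ c →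
      ∃ π : Equiv.Perm (Fin 3), π a = 0 ∧ π b = 1 ∧ π c = 2 := by
  decide

/-- Among the loop-free cyclic words of length 6 over a 3-letter alphabet in which
one letter occurs three times, one twice and one once, there is exactly one class up
to rotation and relabeling, represented by `(1,2,1,2,1,3)`. -/
theorem cyclic_words_three_two_one_unique_class :
    (LoopFree word121213 ∧
      ∃ a b c : Fin 3, Nat.card {i : ZMod 6 // word121213 i = a} = 3 ∧
        Nat.card {i : ZMod 6 // word121213 i = b} = 2 ∧
        Nat.card {i : ZMod 6 // word121213 i = c} = 1) ∧
    (∀ w : ZMod 6 → Fin 3, LoopFree w →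
      (∃ a b c : Fin 3, Nat.card {i : ZMod 6 // w i = a} = 3 ∧
        Nat.card {i : ZMod 6 // w i = b} = 2 ∧
        Nat.card {i : ZMod 6 // w i = c} = 1) →
      SameWord w word121213) := by
  refine ⟨⟨by unfold LoopFree; decide, 0, 1, 2, ?_⟩, ?_⟩
  · simp only [Nat.card_eq_fintype_card]
    decide
  · rintro w hw ⟨a, b, c, ha, hb, hc⟩
    have hab : a ≠ b := by rintro rfl; omega
    have hac : a ≠ c := by rintro rfl; omega
    have hbc : b ≠ c := by rintro rfl; omega
    obtain ⟨hsub, ⟨k, hk⟩⟩ := Nat.card_eq_one_iff_unique.mp hc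
    obtain ⟨h1, h2, h3, h4, h5⟩ := hw.eq_alternating (a := a) (c := c) (k := k)
      (by intro d; omega) hb
      (fun i hi => congrArg Subtype.val (hsub.elim ⟨i, hi⟩ ⟨k, hk⟩))
    obtain ⟨π, ha0, hb1, hc2⟩ := exists_perm_eq_zero_one_two a b c hab hac hbc
    refine ⟨k + 1, π, fun i => ?_⟩
    have hi : i + (k + 1) = k + (i + 1) := by ring
    rw [hi]
    fin_cases i
    · exact ((congrArg π h1).trans ha0).symm
    · exact ((congrArg π h2).trans hb1).symm
    · exact ((congrArg π h3).trans ha0).symm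
    · exact ((congrArg π h4).trans hb1).symm
    · exact ((congrArg π h5).trans ha0).symm
    · change 2 = π (w (k + 0))
      rw [add_zero, hk, hc2]
end

section
/- Up to equivalence (orientation-preserving isomorphism) there is exactly one Newton graph of order 3 in which every vertex has degree 4 and every face has degree 4, and this graph is self-dual. -/
/-! ### Orbits of a permutation -/

theorem cycle_pow_of_orbSize {D : Type} [Finite D] {p : Equiv.Perm D} {n : ℕ} {d : D}
    (h : orbSize p d = n) :
    (p ^ n) d = d ∧ ∀ x, p.SameCycle d x → ∃ i < n, (p ^ i) d = x := by
  classical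
  have hset : {x | p.SameCycle d x} = MulAction.orbit (Subgroup.zpowers p) d := by
    ext x
    constructor
    · rintro ⟨i, hi⟩
      exact ⟨⟨p ^ i, i, rfl⟩, hi⟩
    · rintro ⟨⟨_, i, rfl⟩, hi⟩
      exact ⟨i, hi⟩
  have hper : Function.minimalPeriod p d = n := by
    have := Fintype.ofFinite (MulAction.orbit (Subgroup.zpowers p) d)
    have h1 := MulAction.minimalPeriod_eq_card (a := p) (b := d)
    have h2 : Nat.card {x | p.SameCycle d x} = n := h
    rw [hset, Nat.card_eq_fintype_card] at h2
    exact h1.trans h2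
  have hn : (p ^ n) d = d := by
    rw [← hper, ← Equiv.Perm.iterate_eq_pow]
    exact Function.iterate_minimalPeriod
  have hpos : 0 < n := by
    rw [← h]
    have : Nonempty {x // p.SameCycle d x} := ⟨⟨d, Equiv.Perm.SameCycle.refl p d⟩⟩
    exact Nat.card_pos
  refine ⟨hn, fun x hx => ?_⟩
  obtain ⟨i, hi⟩ := hx.exists_nat_pow_eq
  refine ⟨i % n, Nat.mod_lt _ hpos, ?_⟩
  rw [← hi, ← Equiv.Perm.iterate_eq_pow, ← Equiv.Perm.iterate_eq_pow, ← hper,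
    Function.iterate_mod_minimalPeriod_eq]

theorem sameCycle_iff_of_coloring {D C : Type} {p : Equiv.Perm D} (c : D → C)
    (hinv : ∀ x, c (p x) = c x) (htr : ∀ x y, c x = c y → ∃ i < 4, (p ^ i) x = y) (x y : D) :
    p.SameCycle x y ↔ c x = c y := by
  constructor
  · rintro ⟨i, rfl⟩
    induction i using Int.induction_on with
    | zero => rfl
    | succ n ih =>
      rw [ih, add_comm, zpow_add, zpow_one, Equiv.Perm.mul_apply, hinv]
    | pred n ih =>
      rw [ih, ← hinv ((p ^ (-(n : ℤ) - 1)) x), ← Equiv.Perm.mul_apply, ← zpow_one_add]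
      congr 3
      ring
  · intro h
    obtain ⟨i, -, hi⟩ := htr x y h
    exact ⟨i, by simpa using hi⟩

theorem orbitCount_of_coloring {D : Type} {n : ℕ} {p : Equiv.Perm D} (c : D → Fin n)
    (hc : Function.Surjective c) (h : ∀ x y, p.SameCycle x y ↔ c x = c y) :
    orbitCount p = n := by
  have : Function.Bijective
      (Quotient.lift (s := cycleSetoid p) c fun x y hxy => (h x y).1 hxy) := by
    constructor
    · rintro ⟨x⟩ ⟨y⟩ hxy
      exact Quotient.sound ((h x y).2 hxy)
    · intro k
      obtain ⟨x, rfl⟩ := hc k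
      exact ⟨Quotient.mk _ x, rfl⟩
  exact (Nat.card_eq_of_bijective _ this).trans (Nat.card_fin n)

theorem orbSize_of_coloring {D : Type} [Fintype D] {n : ℕ} {p : Equiv.Perm D} (c : D → Fin n)
    (h : ∀ x y, p.SameCycle x y ↔ c x = c y) (d : D) :
    orbSize p d = Fintype.card {x // c d = c x} := by
  rw [orbSize, ← Nat.card_eq_fintype_card]
  exact Nat.card_congr (Equiv.subtypeEquivRight fun x => h d x)

/-- If `p` has three orbits, two of which are represented by `a` and `b`, then some `c`
represents the third one. -/
theorem exists_third_orbit {D : Type} {p : Equiv.Perm D} (h : orbitCount p = 3) {a b : D}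
    (hab : ¬ p.SameCycle a b) :
    ∃ c, ¬ p.SameCycle a c ∧ ¬ p.SameCycle b c ∧
      ∀ x, p.SameCycle a x ∨ p.SameCycle b x ∨ p.SameCycle c x := by
  classical
  have hfin : Finite (Quotient (cycleSetoid p)) :=
    Nat.finite_of_card_ne_zero (by rw [show Nat.card _ = 3 from h]; norm_num)
  have := Fintype.ofFinite (Quotient (cycleSetoid p))
  have hcard : Fintype.card (Quotient (cycleSetoid p)) = 3 := by
    rw [← Nat.card_eq_fintype_card]
    exact h
  let m : D → Quotient (cycleSetoid p) := Quotient.mk _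
  have hm : ∀ x y, m x = m y ↔ p.SameCycle x y := fun x y =>
    ⟨fun h => Quotient.exact h, fun h => Quotient.sound h⟩
  have hne : m a ≠ m b := fun h => hab ((hm a b).1 h)
  obtain ⟨q, hq⟩ : ∃ q, q ∉ ({m a, m b} : Finset _) := by
    by_contra! hall
    have h1 := Finset.card_le_card (fun q _ => hall q : Finset.univ ⊆ {m a, m b})
    rw [Finset.card_univ, hcard, Finset.card_pair hne] at h1
    omega
  obtain ⟨c, rfl⟩ := Quotient.exists_rep q
  change m c ∉ _ at hq
  simp only [Finset.mem_insert, Finset.mem_singleton, not_or] at hq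
  have huniv : ({m a, m b, m c} : Finset _) = Finset.univ := by
    apply Finset.eq_univ_of_card
    rw [hcard]
    exact Finset.card_eq_three.2 ⟨_, _, _, hne, fun h => hq.1 h.symm, fun h => hq.2 h.symm, rfl⟩
  refine ⟨c, fun h => hq.1 ((hm a c).2 h).symm, fun h => hq.2 ((hm b c).2 h).symm, fun x => ?_⟩
  have hx := huniv ▸ Finset.mem_univ (m x)
  simp only [Finset.mem_insert, Finset.mem_singleton] at hx
  simp only [← hm]
  tauto

/-! ### The model -/

/-- Three vertices of degree four: the counterclockwise successor of the dart `4 * v + i`. -/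
def rotFour : Equiv.Perm (Fin 12) where
  toFun := ![1, 2, 3, 0, 5, 6, 7, 4, 9, 10, 11, 8]
  invFun := ![3, 0, 1, 2, 7, 4, 5, 6, 11, 8, 9, 10]
  left_inv := by decide
  right_inv := by decide

/-- The edges of the square grid modulo the lattice `{(x, y) | 3 ∣ x + y}`. -/
def gridFlip : Equiv.Perm (Fin 12) where
  toFun := ![4, 5, 8, 9, 0, 1, 10, 11, 2, 3, 6, 7]
  invFun := ![4, 5, 8, 9, 0, 1, 10, 11, 2, 3, 6, 7]
  left_inv := by decide
  right_inv := by decide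

/-- The vertex of a dart. -/
def vertexColor : Fin 12 → Fin 3 := ![0, 0, 0, 0, 1, 1, 1, 1, 2, 2, 2, 2]

/-- The face of a dart. -/
def faceColor : Fin 12 → Fin 3 := ![0, 1, 0, 2, 1, 0, 1, 2, 2, 0, 2, 1]

theorem sameCycle_rotFour (x y : Fin 12) :
    rotFour.SameCycle x y ↔ vertexColor x = vertexColor y :=
  sameCycle_iff_of_coloring vertexColor (by decide) (by decide +kernel) x y

theorem sameCycle_rotFour_mul_gridFlip (x y : Fin 12) :
    (rotFour * gridFlip).SameCycle x y ↔ faceColor x = faceColor y :=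
  sameCycle_iff_of_coloring faceColor (by decide) (by decide +kernel) x y

theorem isNewtonGraph_rotFour_gridFlip : IsNewtonGraph 3 rotFour gridFlip := by
  have htr : ∀ d d' : Fin 12, ∃ i < 4, ∃ k < 2, ∃ j < 4,
      (rotFour ^ i * gridFlip ^ k * rotFour ^ j) d = d' := by decide +kernel
  refine ⟨⟨by norm_num, by simp, by decide, by decide, fun d d' => ?_,
    orbitCount_of_coloring _ (by decide) sameCycle_rotFour,
    orbitCount_of_coloring _ (by decide) sameCycle_rotFour_mul_gridFlip, ?_⟩, ?_, ?_⟩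
  · obtain ⟨i, -, k, -, j, -, h⟩ := htr d d'
    have hσ : rotFour ∈ Subgroup.closure {rotFour, gridFlip} :=
      Subgroup.subset_closure (by simp)
    have hα : gridFlip ∈ Subgroup.closure {rotFour, gridFlip} :=
      Subgroup.subset_closure (by simp)
    exact ⟨_, mul_mem (mul_mem (pow_mem hσ i) (pow_mem hα k)) (pow_mem hσ j), h⟩
  · simp only [sameCycle_rotFour]
    decide
  · simp only [sameCycle_rotFour_mul_gridFlip]
    decide
  · simp only [sameCycle_rotFour_mul_gridFlip, sameCycle_rotFour]
    decide

theorem mapSelfDual_rotFour_gridFlip : MapSelfDual rotFour gridFlip := by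
  let e : Equiv.Perm (Fin 12) :=
    { toFun := ![1, 4, 11, 6, 5, 0, 9, 2, 7, 10, 3, 8]
      invFun := ![5, 0, 7, 10, 1, 4, 3, 8, 11, 6, 9, 2]
      left_inv := by decide
      right_inv := by decide }
  have h1 : ∀ d, (rotFour * gridFlip) (e (rotFour d)) = e d := by decide
  have h2 : ∀ d, e (gridFlip d) = gridFlip (e d) := by decide
  exact ⟨e, fun d => Equiv.Perm.eq_inv_iff_eq.2 (h1 d), h2⟩

/-! ### Exhaustive search for edge involutions -/

/-- The rotation `rotFour` on natural numbers. -/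
def rotNat (k : ℕ) : ℕ := k / 4 * 4 + (k + 1) % 4

/-- In the partial involution described by the association list `l`, the face of `x` is not yet
closed, or it is a quadrangle meeting all vertices. -/
def faceOK (l : List (ℕ × ℕ)) (x : ℕ) : Bool :=
  match l.lookup x with
  | none => true
  | some y₀ => match l.lookup (rotNat y₀) with
    | none => true
    | some y₁ => match l.lookup (rotNat y₁) with
      | none => true
      | some y₂ => match l.lookup (rotNat y₂) with
        | none => true
        | some y₃ => rotNat y₃ == x && [0, 1, 2].all fun v =>
            x / 4 == v || rotNat y₀ / 4 == v || rotNat y₁ / 4 == v || rotNat y₂ / 4 == v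

/-- Matching the darts `k` and `v` is compatible with `l`; the partner of `0` is normalized
to `4`. -/
def matchOK (l : List (ℕ × ℕ)) (k v : ℕ) : Bool :=
  v / 4 != k / 4 && (k != 0 || v == 4) && (l.lookup v).all (· == k) &&
    faceOK ((k, v) :: (v, k) :: l) k && faceOK ((k, v) :: (v, k) :: l) v

/-- The darts at the vertices of `d`, of its partner in `l` and of the partner of the dart opposite
to `d`, in the order of the model. -/
def modelDarts (l : List (ℕ × ℕ)) (d : ℕ) : List ℕ :=
  let orb (x : ℕ) : List ℕ := [x, rotNat x, rotNat (rotNat x), rotNat (rotNat (rotNat x))]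
  orb d ++ orb ((l.lookup d).getD 0) ++ orb ((l.lookup (rotNat (rotNat d))).getD 0)

/-- The darts `g` form an isomorphic copy of the model inside `(rotNat, l)`. -/
def isModelCopy (l : List (ℕ × ℕ)) (g : List ℕ) : Bool :=
  (List.finRange 12).all fun i =>
    g.getD i 0 < 12 && g.getD (rotFour i) 0 == rotNat (g.getD i 0) &&
      l.lookup (g.getD i 0) == some (g.getD (gridFlip i) 0) &&
      (List.finRange 12).all fun j => g.getD i 0 != g.getD j 0 || i == j

/-- All ways of extending `l` by partners for the darts `ks` lead to a copy of the model. -/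
def searchAll : List ℕ → List (ℕ × ℕ) → Bool
  | [], l => isModelCopy l (modelDarts l 0) || isModelCopy l (modelDarts l 1)
  | k :: ks, l => match l.lookup k with
    | some _ => searchAll ks l
    | none => (List.range 12).all fun v =>
        !matchOK l k v || searchAll ks ((k, v) :: (v, k) :: l)

theorem searchAll_range : searchAll (List.range 12) [] = true := by
  decide +kernel

theorem apply_eq_of_lookup {a : ℕ → ℕ} {l : List (ℕ × ℕ)} (hl : ∀ p ∈ l, a p.1 = p.2) {x y : ℕ}
    (h : l.lookup x = some y) : a x = y := by
  obtain ⟨l₁, l₂, rfl, -⟩ := List.lookup_eq_some_iff.1 h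
  exact hl (x, y) (by simp)

/-- The edge involution `a` has no loops, and its faces are quadrangles meeting all vertices. -/
structure IsGoodFlip (a : ℕ → ℕ) : Prop where
  lt : ∀ k, a k < 12
  invol : ∀ k < 12, a (a k) = k
  loopless : ∀ k < 12, a k / 4 ≠ k / 4
  zero : a 0 = 4
  face : ∀ k < 12, rotNat (a (rotNat (a (rotNat (a (rotNat (a k))))))) = k
  euler : ∀ k < 12, ∀ v < 3, k / 4 = v ∨ rotNat (a k) / 4 = v ∨
    rotNat (a (rotNat (a k))) / 4 = v ∨ rotNat (a (rotNat (a (rotNat (a k))))) / 4 = v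

namespace IsGoodFlip

variable {a : ℕ → ℕ} {l : List (ℕ × ℕ)}

theorem faceOK (ha : IsGoodFlip a) (hl : ∀ p ∈ l, a p.1 = p.2) {x : ℕ} (hx : x < 12) :
    faceOK l x = true := by
  rw [_root_.faceOK]
  split
  · rfl
  rename_i y₀ h₀
  split
  · rfl
  rename_i y₁ h₁
  split
  · rfl
  rename_i y₂ h₂
  split
  · rfl
  rename_i y₃ h₃
  have hf := ha.face x hx
  have he := ha.euler x hx
  rw [apply_eq_of_lookup hl h₀, apply_eq_of_lookup hl h₁, apply_eq_of_lookup hl h₂] at hf he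
  rw [apply_eq_of_lookup hl h₃] at hf
  rw [Bool.and_eq_true, List.all_eq_true]
  refine ⟨by simpa using hf, fun v hv => ?_⟩
  have := he v (by simp only [List.mem_cons, List.not_mem_nil, or_false] at hv; omega)
  simpa [or_assoc] using this

theorem cons_cons (ha : IsGoodFlip a) (hl : ∀ p ∈ l, a p.1 = p.2) {k : ℕ} (hk : k < 12) :
    ∀ p ∈ (k, a k) :: (a k, k) :: l, a p.1 = p.2 := by
  intro p hp
  rcases List.mem_cons.1 hp with rfl | hp
  · rfl
  rcases List.mem_cons.1 hp with rfl | hp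
  · exact ha.invol k hk
  · exact hl p hp

theorem matchOK (ha : IsGoodFlip a) (hl : ∀ p ∈ l, a p.1 = p.2) {k : ℕ} (hk : k < 12) :
    matchOK l k (a k) = true := by
  simp only [_root_.matchOK, ha.faceOK (ha.cons_cons hl hk) hk,
    ha.faceOK (ha.cons_cons hl hk) (ha.lt k), Bool.and_true, Bool.and_eq_true]
  refine ⟨⟨?_, ?_⟩, ?_⟩
  · simpa using ha.loopless k hk
  · rcases Nat.eq_zero_or_pos k with rfl | h
    · simp [ha.zero]
    · simp [h.ne']
  · cases h : l.lookup (a k) with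
    | none => rfl
    | some w => simp [← apply_eq_of_lookup hl h, ha.invol k hk]

theorem exists_isModelCopy (ha : IsGoodFlip a) : ∀ (ks : List ℕ) (l : List (ℕ × ℕ)),
    (∀ k ∈ ks, k < 12) → (∀ p ∈ l, a p.1 = p.2) → searchAll ks l = true →
      ∃ l' g, (∀ p ∈ l', a p.1 = p.2) ∧ isModelCopy l' g = true
  | [], l, _, hl, h => by
    rw [searchAll, Bool.or_eq_true] at h
    rcases h with h | h
    · exact ⟨l, _, hl, h⟩
    · exact ⟨l, _, hl, h⟩
  | k :: ks, l, hks, hl, h => by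
    have hks' : ∀ k ∈ ks, k < 12 := fun i hi => hks i (List.mem_cons_of_mem _ hi)
    have hk : k < 12 := hks k List.mem_cons_self
    rw [searchAll] at h
    split at h
    · exact exists_isModelCopy ha ks l hks' hl h
    · rw [List.all_eq_true] at h
      have := h (a k) (List.mem_range.2 (ha.lt k))
      rw [ha.matchOK hl hk] at this
      exact exists_isModelCopy ha ks _ hks' (ha.cons_cons hl hk) (by simpa using this)

theorem exists_model_labels (ha : IsGoodFlip a) :
    ∃ g : Fin 12 → ℕ, Function.Injective g ∧ (∀ i, g i < 12) ∧
      (∀ i, g (rotFour i) = rotNat (g i)) ∧ ∀ i, g (gridFlip i) = a (g i) := by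
  obtain ⟨l, g, hl, hg⟩ := ha.exists_isModelCopy (List.range 12) []
    (fun k hk => List.mem_range.1 hk) (by simp) searchAll_range
  simp only [isModelCopy, List.all_eq_true, List.mem_finRange, forall_const, Bool.and_eq_true,
    Bool.or_eq_true, bne_iff_ne, beq_iff_eq, decide_eq_true_eq] at hg
  exact ⟨fun i => g.getD i 0, fun i j hij => ((hg i).2 j).resolve_left (fun h => h hij),
    fun i => (hg i).1.1.1, fun i => (hg i).1.1.2,
    fun i => (apply_eq_of_lookup hl (hg i).1.2).symm⟩

end IsGoodFlip

/-! ### Labelling the darts of a map -/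

/-- Labels for the darts of vertices of degree four with representatives `rep 0`, `rep 1`, … -/
def dartLabel {D : Type} (σ : Equiv.Perm D) (rep : ℕ → D) (k : ℕ) : D :=
  (σ ^ (k % 4)) (rep (k / 4))

theorem dartLabel_rotNat {D : Type} {σ : Equiv.Perm D} (h4 : σ ^ 4 = 1) (rep : ℕ → D) (k : ℕ) :
    dartLabel σ rep (rotNat k) = σ (dartLabel σ rep k) := by
  have h1 : rotNat k / 4 = k / 4 := by
    unfold rotNat
    omega
  have h2 : rotNat k % 4 = (k + 1) % 4 := by
    unfold rotNat
    omega
  have hmod : ∀ m : ℕ, σ ^ (m % 4) = σ ^ m := fun m => by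
    conv_rhs => rw [← Nat.div_add_mod m 4, pow_add, pow_mul, h4, one_pow, one_mul]
  rw [dartLabel, dartLabel, h1, h2, hmod, hmod, pow_succ', Equiv.Perm.mul_apply]

/-- A Newton graph of order three with all degrees four admits a labelling of its darts for which
the rotation is `rotNat`. -/
theorem exists_isGoodFlip {D : Type} {σ α : Equiv.Perm D} (h : IsNewtonGraph 3 σ α)
    (hσ : ∀ d, orbSize σ d = 4) (hφ : ∀ d, orbSize (σ * α) d = 4) :
    ∃ (a : ℕ → ℕ) (E : ℕ → D), IsGoodFlip a ∧ (∀ k, E (a k) = α (E k)) ∧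
      (∀ k, E (rotNat k) = σ (E k)) ∧ ∀ i < 12, ∀ j < 12, E i = E j → i = j := by
  obtain ⟨⟨-, hcard, -, hinv, -, hcount, -, hloop⟩, -, hcover⟩ := h
  have : Finite D := Nat.finite_of_card_ne_zero (by omega)
  obtain ⟨d⟩ : Nonempty D := (Nat.card_pos_iff.1 (by omega : 0 < Nat.card D)).1
  obtain ⟨c, hac, hbc, hall⟩ := exists_third_orbit hcount (hloop d)
  let rep : ℕ → D
    | 0 => d
    | 1 => α d
    | _ => c
  let E := dartLabel σ rep
  have hE : ∀ k, E (rotNat k) = σ (E k) :=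
    dartLabel_rotNat (Equiv.ext fun x => (cycle_pow_of_orbSize (hσ x)).1) rep
  have hrep : ∀ k, σ.SameCycle (rep (k / 4)) (E k) := fun k => ⟨(k % 4 : ℕ), by
    rw [zpow_natCast]
    rfl⟩
  have hsurj : ∀ x, ∃ k < 12, E k = x := by
    intro x
    obtain ⟨v, hv, hx⟩ : ∃ v < 3, σ.SameCycle (rep v) x := by
      rcases hall x with h | h | h
      · exact ⟨0, by omega, h⟩
      · exact ⟨1, by omega, h⟩
      · exact ⟨2, by omega, h⟩
    obtain ⟨i, hi, rfl⟩ := (cycle_pow_of_orbSize (hσ _)).2 x hx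
    refine ⟨4 * v + i, by omega, ?_⟩
    rw [show E (4 * v + i) = (σ ^ ((4 * v + i) % 4)) (rep ((4 * v + i) / 4)) from rfl,
      show (4 * v + i) % 4 = i by omega, show (4 * v + i) / 4 = v by omega]
  have hinj : ∀ i < 12, ∀ j < 12, E i = E j → i = j := by
    have hbij : Function.Bijective fun i : Fin 12 => E i := by
      refine Function.Surjective.bijective_of_nat_card_le (fun x => ?_) (by simp [hcard])
      obtain ⟨k, hk, hx⟩ := hsurj x
      exact ⟨⟨k, hk⟩, hx⟩
    intro i hi j hj hij
    exact congrArg Fin.val (hbij.1 (a₁ := ⟨i, hi⟩) (a₂ := ⟨j, hj⟩) hij)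
  have hvert : ∀ v < 3, ∀ m < 12, σ.SameCycle (rep v) (E m) → m / 4 = v := by
    intro v hv m hm hvm
    have hab : σ.SameCycle (rep v) (rep (m / 4)) := hvm.trans (hrep m).symm
    have hm3 : m / 4 < 3 := by omega
    generalize m / 4 = w at hab hm3
    have hdα := hloop d
    interval_cases v <;> interval_cases w <;> first
      | rfl
      | exact absurd hab ‹_›
      | exact absurd hab.symm ‹_›
  choose a ha hα using fun k => hsurj (α (E k))
  have hstep : ∀ k, E (rotNat (a k)) = (σ * α) (E k) := fun k => by
    rw [hE, hα, Equiv.Perm.mul_apply]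
  have hlt : ∀ k < 12, rotNat k < 12 := fun k hk => by
    unfold rotNat
    omega
  have hlt' : ∀ k, rotNat (a k) < 12 := fun k => hlt _ (ha k)
  refine ⟨a, E, ⟨ha, fun k hk => ?_, fun k hk hak => ?_, ?_, fun k hk => ?_,
    fun k hk v hv => ?_⟩, hα, hE, hinj⟩
  · exact hinj _ (ha _) _ hk (by rw [hα, hα, hinv])
  · refine hloop (E k) ?_
    rw [← hα]
    have := hrep (a k)
    rw [hak] at this
    exact (hrep k).symm.trans this
  · exact hinj _ (ha _) _ (by omega) (hα 0)
  · refine hinj _ (hlt' _) _ hk ?_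
    rw [hstep, hstep, hstep, hstep]
    exact (cycle_pow_of_orbSize (hφ (E k))).1
  · obtain ⟨x, hx, hvx⟩ := hcover (E k) (rep v)
    obtain ⟨i, hi, rfl⟩ := (cycle_pow_of_orbSize (hφ _)).2 x hx
    interval_cases i
    · exact .inl (hvert v hv _ hk hvx)
    · refine .inr (.inl (hvert v hv _ (hlt' _) ?_))
      rw [hstep]
      exact hvx
    · refine .inr (.inr (.inl (hvert v hv _ (hlt' _) ?_)))
      rw [hstep, hstep]
      exact hvx
    · refine .inr (.inr (.inr (hvert v hv _ (hlt' _) ?_)))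
      rw [hstep, hstep, hstep]
      exact hvx

theorem mapEquiv_rotFour_gridFlip {D : Type} {σ α : Equiv.Perm D} (h : IsNewtonGraph 3 σ α)
    (hσ : ∀ d, orbSize σ d = 4) (hφ : ∀ d, orbSize (σ * α) d = 4) :
    MapEquiv σ α rotFour gridFlip := by
  obtain ⟨a, E, ha, hα, hE, hinj⟩ := exists_isGoodFlip h hσ hφ
  obtain ⟨g, hg, hlt, hrot, hflip⟩ := ha.exists_model_labels
  have hcard : Nat.card D = 12 := h.1.2.1
  have : Finite D := Nat.finite_of_card_ne_zero (by omega)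
  have hbij : Function.Bijective fun i => E (g i) :=
    Function.Injective.bijective_of_nat_card_le
      (fun i j hij => hg (hinj _ (hlt i) _ (hlt j) hij)) (by simp [hcard])
  let e : Fin 12 ≃ D := Equiv.ofBijective _ hbij
  have he : ∀ i, e i = E (g i) := fun _ => rfl
  refine ⟨e.symm, fun x => ?_, fun x => ?_⟩
  · obtain ⟨i, rfl⟩ := e.surjective x
    rw [Equiv.symm_apply_eq, Equiv.symm_apply_apply, he, he, hrot, hE]
  · obtain ⟨i, rfl⟩ := e.surjective x
    rw [Equiv.symm_apply_eq, Equiv.symm_apply_apply, he, he, hflip, hα]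

/-- Up to equivalence there is exactly one Newton graph of order 3 in which every
vertex has degree 4 and every face has degree 4, and this graph is self-dual. -/
theorem newton_graphs_order3_all_degrees_four_unique :
    ∃ σ₀ α₀ : Equiv.Perm (Fin 12),
      (IsNewtonGraph 3 σ₀ α₀ ∧ (∀ d, orbSize σ₀ d = 4) ∧
        (∀ d, orbSize (σ₀ * α₀) d = 4)) ∧
      MapSelfDual σ₀ α₀ ∧
      (∀ (D : Type) (σ α : Equiv.Perm D),
        IsNewtonGraph 3 σ α → (∀ d, orbSize σ d = 4) →
        (∀ d, orbSize (σ * α) d = 4) → MapEquiv σ α σ₀ α₀) := by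
  refine ⟨rotFour, gridFlip, ⟨isNewtonGraph_rotFour_gridFlip, fun d => ?_, fun d => ?_⟩,
    mapSelfDual_rotFour_gridFlip, fun D σ α h hσ hφ => ?_⟩
  · rw [orbSize_of_coloring vertexColor sameCycle_rotFour]
    revert d
    decide
  · rw [orbSize_of_coloring faceColor sameCycle_rotFour_mul_gridFlip]
    revert d
    decide
  · exact mapEquiv_rotFour_gridFlip h hσ hφ
end
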